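/- Let p be a prime number and let E be an elliptic curve over the finite field 𝔽_p, with N_p the number of 𝔽_p-rational points of E (including the point at infinity). Then there exists a real number θ with 0 ≤ θ ≤ π such that (p + 1 − N_p : ℝ) = 2·√p·cos θ. -/

import Mathlib

open Polynomial

namespace WeierstrassCurve

/-- The values of the polynomials `addSubMap W` at a coordinate vector. -/
noncomputable def addSubVec {R : Type*} [CommRing R] (W : WeierstrassCurve R) (v : Fin 3 → R) :
    Fin 3 → R :=
  fun i ↦ MvPolynomial.eval v (addSubMap W i)

section CommRing

variable {R : Type*} [CommRing R] (W : WeierstrassCurve R)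

lemma addSubVec_eq (s t u : R) : W.addSubVec ![s, t, u] =
    ![s ^ 2 - W.b₄ * s * u - W.b₆ * t * u - W.b₈ * u ^ 2,
      2 * t * s + W.b₂ * s * u + W.b₄ * t * u + W.b₆ * u ^ 2, t ^ 2 - 4 * s * u] := by
  ext i
  fin_cases i <;> simp [addSubVec, addSubMap]

lemma addSubVec_ne_zero [W.IsElliptic] [IsReduced R] {v : Fin 3 → R} (hv : v ≠ 0) :
    W.addSubVec v ≠ 0 :=
  addSubMap_ne_zero W hv

lemma eq_vec3 {α : Type*} (v : Fin 3 → α) : v = ![v 0, v 1, v 2] := by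
  ext i
  fin_cases i <;> rfl

lemma map_addSubVec {S : Type*} [CommRing S] (f : R →+* S) (v : Fin 3 → R) (i : Fin 3) :
    f (W.addSubVec v i) = (W.map f).addSubVec (fun j ↦ f (v j)) i := by
  rw [eq_vec3 v, eq_vec3 (fun j ↦ f _), addSubVec_eq, addSubVec_eq]
  fin_cases i <;> simp [map_ofNat]

lemma addSubVec_smul (c : R) (v : Fin 3 → R) : W.addSubVec (c • v) = c ^ 2 • W.addSubVec v := by
  rw [eq_vec3 v, eq_vec3 (c • _), addSubVec_eq, addSubVec_eq]
  ext i
  fin_cases i <;> simp <;> ring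

end CommRing

namespace Affine.Point

variable {F : Type*} [Field F] [DecidableEq F] {W : Affine F}

lemma exists_addSubVec_sym2x_self [W.IsElliptic] (P : W.Point) :
    ∃ k : F, k ≠ 0 ∧ W.addSubVec (P.sym2x P) = k • (P + P).sym2x 0 := by
  rcases P with _ | ⟨x, y, h⟩
  · refine ⟨1, one_ne_zero, ?_⟩
    rw [← zero_def, add_zero, sym2x_zero_zero, addSubVec_eq]
    ext i
    fin_cases i <;> simp
  have heq := (W.equation_iff x y).1 h.1
  by_cases hy : y = W.negY x y
  · have hne := W.addSubVec_ne_zero (sym2x_ne_zero (some x y h) (some x y h))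
    rw [add_self_of_Y_eq hy, sym2x_zero_zero]
    rw [sym2x_some_some, addSubVec_eq] at hne ⊢
    have h1 : 2 * (x + x) * (x * x) + W.b₂ * (x * x) * 1 + W.b₄ * (x + x) * 1 + W.b₆ * 1 ^ 2
        = 0 := by
      have : 2 * y + W.a₁ * x + W.a₃ = 0 := by rw [negY] at hy; linear_combination hy
      simp only [b₂, b₄, b₆]
      linear_combination (-4) * heq + (2 * y + W.a₁ * x + W.a₃) * this
    have h2 : (x + x) ^ 2 - 4 * (x * x) * 1 = 0 := by ring
    rw [h1, h2] at hne ⊢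
    generalize (x * x) ^ 2 - W.b₄ * (x * x) * 1 - W.b₆ * (x + x) * 1 - W.b₈ * 1 ^ 2 = k at hne ⊢
    exact ⟨k, by simpa using hne, by simp⟩
  · have hk : 2 * y + W.a₁ * x + W.a₃ ≠ 0 := fun h0 ↦ hy <| by
      rw [negY]; linear_combination h0
    refine ⟨(2 * y + W.a₁ * x + W.a₃) ^ 2, pow_ne_zero 2 hk, ?_⟩
    rw [add_self_of_Y_ne hy, sym2x_some_zero, sym2x_some_some, addSubVec_eq]
    have hs : W.slope x x y y * (2 * y + W.a₁ * x + W.a₃) =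
        3 * x ^ 2 + 2 * W.a₂ * x + W.a₄ - W.a₁ * y := by
      rw [slope_of_Y_ne rfl hy, negY, show y - (-y - W.a₁ * x - W.a₃) =
        2 * y + W.a₁ * x + W.a₃ by ring, div_mul_cancel₀ _ hk]
    ext i
    fin_cases i
    · simp only [b₄, b₆, b₈, addX, Fin.zero_eta, Matrix.cons_val_zero, Pi.smul_apply, smul_eq_mul]
      generalize W.slope x x y y = l at *
      grind
    · simp only [b₂, b₄, b₆, Fin.mk_one, Matrix.cons_val_one, Matrix.cons_val_zero, Pi.smul_apply,
        smul_eq_mul]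
      linear_combination (-4) * heq
    · simp
      ring

lemma addSubVec_sym2x_of_X_ne {x₁ y₁ x₂ y₂ : F} (h₁ : W.Nonsingular x₁ y₁)
    (h₂ : W.Nonsingular x₂ y₂) (hx : x₁ ≠ x₂) :
    W.addSubVec ((some x₁ y₁ h₁).sym2x (some x₂ y₂ h₂)) = (x₁ - x₂) ^ 2 •
      (some x₁ y₁ h₁ + some x₂ y₂ h₂).sym2x (some x₁ y₁ h₁ - some x₂ y₂ h₂) := by
  have hd : x₁ - x₂ ≠ 0 := sub_ne_zero.2 hx
  have e₁ := (W.equation_iff x₁ y₁).1 h₁.1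
  have e₂ := (W.equation_iff x₂ y₂).1 h₂.1
  rw [sub_eq_add_neg (some x₁ y₁ h₁), neg_some, add_of_X_ne hx, add_of_X_ne hx, sym2x_some_some,
    sym2x_some_some, addSubVec_eq]
  have s₁ : W.slope x₁ x₂ y₁ y₂ * (x₁ - x₂) = y₁ - y₂ := by
    rw [slope_of_X_ne hx, div_mul_cancel₀ _ hd]
  have s₂ : W.slope x₁ x₂ y₁ (W.negY x₂ y₂) * (x₁ - x₂) = y₁ + y₂ + W.a₁ * x₂ + W.a₃ := by
    rw [slope_of_X_ne hx, div_mul_cancel₀ _ hd, negY]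
    ring
  generalize W.slope x₁ x₂ y₁ y₂ = l at s₁ ⊢
  generalize W.slope x₁ x₂ y₁ (W.negY x₂ y₂) = m at s₂ ⊢
  have t₁ : W.addX x₁ x₂ l * (x₁ - x₂) ^ 2 = (y₁ - y₂) ^ 2 + W.a₁ * (y₁ - y₂) * (x₁ - x₂)
      - (W.a₂ + x₁ + x₂) * (x₁ - x₂) ^ 2 := by
    rw [addX, ← s₁]
    ring
  have t₂ : W.addX x₁ x₂ m * (x₁ - x₂) ^ 2 = (y₁ + y₂ + W.a₁ * x₂ + W.a₃) ^ 2 +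
      W.a₁ * (y₁ + y₂ + W.a₁ * x₂ + W.a₃) * (x₁ - x₂)
      - (W.a₂ + x₁ + x₂) * (x₁ - x₂) ^ 2 := by
    rw [addX, ← s₂]
    ring
  generalize W.addX x₁ x₂ l = r at t₁ ⊢
  generalize W.addX x₁ x₂ m = r' at t₂ ⊢
  ext i
  fin_cases i
  · refine mul_right_cancel₀ (pow_ne_zero 2 hd) ?_
    have : (x₁ - x₂) ^ 2 * (r * r') * (x₁ - x₂) ^ 2 =
      (r * (x₁ - x₂) ^ 2) * (r' * (x₁ - x₂) ^ 2) := by ring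
    simp only [Fin.zero_eta, Matrix.cons_val_zero, Pi.smul_apply, smul_eq_mul, this, t₁, t₂]
    simp only [b₄, b₆, b₈]
    clear this t₁ t₂ s₁ s₂ hd
    generalize W.a₁ = a₁, W.a₂ = a₂, W.a₃ = a₃, W.a₄ = a₄, W.a₆ = a₆ at *
    grind
  · simp only [Fin.mk_one, Matrix.cons_val_one, Matrix.cons_val_zero, Pi.smul_apply, smul_eq_mul,
      mul_add]
    rw [mul_comm _ r, mul_comm _ r', t₁, t₂]
    simp only [b₂, b₄, b₆]
    linear_combination (-2) * e₁ - 2 * e₂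
  · simp
    ring

/-- The map `addSubVec` sends the class of `(x(P), x(Q))` to the class of `(x(P + Q), x(P - Q))`. -/
theorem exists_addSubVec_sym2x [W.IsElliptic] (P Q : W.Point) :
    ∃ k : F, k ≠ 0 ∧ W.addSubVec (P.sym2x Q) = k • (P + Q).sym2x (P - Q) := by
  by_cases hPQ : P.xRep = Q.xRep
  · rcases eq_or_eq_neg_of_xRep_eq_xRep hPQ with rfl | rfl
    · simpa using exists_addSubVec_sym2x_self P
    · rw [sym2x_neg_left, neg_add_cancel, ← neg_add', sym2x_neg_right, sym2x_comm 0]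
      exact exists_addSubVec_sym2x_self Q
  rcases P with _ | ⟨x₁, y₁, h₁⟩
  · rcases Q with _ | ⟨x₂, y₂, h₂⟩
    · exact absurd rfl hPQ
    · refine ⟨1, one_ne_zero, ?_⟩
      rw [← zero_def, zero_add, zero_sub, sym2x_neg_right, sym2x_zero_some, sym2x_some_some,
        addSubVec_eq]
      ext i
      fin_cases i <;> simp <;> ring
  · rcases Q with _ | ⟨x₂, y₂, h₂⟩
    · refine ⟨1, one_ne_zero, ?_⟩
      rw [← zero_def, add_zero, sub_zero, sym2x_some_zero, sym2x_some_some, addSubVec_eq]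
      ext i
      fin_cases i <;> simp <;> ring
    · have hx : x₁ ≠ x₂ := by rintro rfl; simp at hPQ
      exact ⟨_, pow_ne_zero 2 (sub_ne_zero.2 hx), addSubVec_sym2x_of_X_ne h₁ h₂ hx⟩

end Affine.Point
end WeierstrassCurve

/-- `HasHeight u n` says that `n` is the largest degree among the polynomials `u i`. -/
def Polynomial.HasHeight {K ι : Type*} [Field K] (u : ι → K[X]) (n : ℕ) : Prop :=
  (∀ i, (u i).natDegree ≤ n) ∧ ∃ i, (u i).coeff n ≠ 0

/-- A family of ring elements is primitive if no maximal ideal contains all of its members. -/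
def IsPrimitiveFamily {R ι : Type*} [CommRing R] (u : ι → R) : Prop :=
  ∀ M : Ideal R, M.IsMaximal → ∃ i, u i ∉ M

section Primitive

variable {R ι : Type*} [CommRing R]

lemma IsPrimitiveFamily.exists_sum_eq_one [Fintype ι] {u : ι → R} (hu : IsPrimitiveFamily u) :
    ∃ c : ι → R, ∑ i, c i * u i = 1 := by
  have h : Ideal.span (Set.range u) = ⊤ := by
    by_contra h
    obtain ⟨M, hM, hle⟩ := Ideal.exists_le_maximal _ h
    obtain ⟨i, hi⟩ := hu M hM
    exact hi (hle (Ideal.subset_span ⟨i, rfl⟩))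
  have h1 : (1 : R) ∈ Ideal.span (Set.range u) := h ▸ Submodule.mem_top
  simpa using Ideal.mem_span_range_iff_exists_fun.1 h1

lemma IsCoprime.isPrimitiveFamily {f g : R} (h : IsCoprime f g) : IsPrimitiveFamily ![f, g] := by
  intro M hM
  by_contra! hc
  obtain ⟨a, b, hab⟩ := h
  exact hM.ne_top ((Ideal.eq_top_iff_one M).2
    (hab ▸ M.add_mem (M.mul_mem_left _ (hc 0)) (M.mul_mem_left _ (hc 1))))

/-- The coefficients of the product of two linear forms. -/
def symProd (u v : Fin 2 → R) : Fin 3 → R :=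
  ![u 0 * v 0, u 0 * v 1 + u 1 * v 0, u 1 * v 1]

lemma symProd_ne_zero [IsDomain R] {u v : Fin 2 → R} (hu : u ≠ 0) (hv : v ≠ 0) :
    symProd u v ≠ 0 := by
  intro h
  have h0 : u 0 * v 0 = 0 := congr_fun h 0
  have h1 : u 0 * v 1 + u 1 * v 0 = 0 := congr_fun h 1
  have h2 : u 1 * v 1 = 0 := congr_fun h 2
  have hu' : ¬ (u 0 = 0 ∧ u 1 = 0) := fun h ↦ hu (by ext i; fin_cases i <;> simp [h])
  have hv' : ¬ (v 0 = 0 ∧ v 1 = 0) := fun h ↦ hv (by ext i; fin_cases i <;> simp [h])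
  rcases mul_eq_zero.1 h0 with h0 | h0 <;> rcases mul_eq_zero.1 h2 with h2 | h2 <;> simp_all

lemma IsPrimitiveFamily.symProd {u v : Fin 2 → R} (hu : IsPrimitiveFamily u)
    (hv : IsPrimitiveFamily v) : IsPrimitiveFamily (symProd u v) := by
  intro M hM
  have key : ∀ w : Fin 2 → R, IsPrimitiveFamily w → (fun i ↦ Ideal.Quotient.mk M (w i)) ≠ 0 := by
    intro w hw h0
    obtain ⟨i, hi⟩ := hw M hM
    exact hi (Ideal.Quotient.eq_zero_iff_mem.1 (congr_fun h0 i))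
  by_contra! hc
  refine symProd_ne_zero (key u hu) (key v hv) ?_
  ext i
  have := Ideal.Quotient.eq_zero_iff_mem.2 (hc i)
  rw [Pi.zero_apply, ← this]
  fin_cases i <;> simp [_root_.symProd]

end Primitive

namespace Polynomial.HasHeight

variable {K ι : Type*} [Field K]

lemma unique_of_cross_mul [Fintype ι] {u v : ι → K[X]} (hu : IsPrimitiveFamily u)
    (hv : IsPrimitiveFamily v) (h : ∀ i j, u i * v j = u j * v i) {m n : ℕ} (hm : HasHeight u m)
    (hn : HasHeight v n) : m = n := by
  obtain ⟨c, hc⟩ := hu.exists_sum_eq_one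
  obtain ⟨d, hd⟩ := hv.exists_sum_eq_one
  have hu' : ∀ i, u i = (∑ j, d j * u j) * v i := fun i ↦ by
    rw [Finset.sum_mul, ← mul_one (u i), ← hd, Finset.mul_sum]
    exact Finset.sum_congr rfl fun j _ ↦ by linear_combination d j * h i j
  have hv' : ∀ i, v i = (∑ j, c j * v j) * u i := fun i ↦ by
    rw [Finset.sum_mul, ← mul_one (v i), ← hc, Finset.mul_sum]
    exact Finset.sum_congr rfl fun j _ ↦ by linear_combination c j * h j i
  have hunit : IsUnit (∑ j, d j * u j) := by
    obtain ⟨i, hi⟩ := hm.2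
    have hi' : u i ≠ 0 := fun h0 ↦ hi (by simp [h0])
    refine IsUnit.of_mul_eq_one (∑ j, c j * v j) (mul_right_cancel₀ hi' ?_)
    rw [mul_assoc, ← hv', ← hu', one_mul]
  obtain ⟨r, hr, hr'⟩ := isUnit_iff.1 hunit
  rw [← hr'] at hu'
  have hdeg : ∀ i, (u i).natDegree = (v i).natDegree := fun i ↦ by
    rw [hu', natDegree_C_mul hr.ne_zero]
  obtain ⟨i, hi⟩ := hm.2
  obtain ⟨j, hj⟩ := hn.2
  exact le_antisymm ((le_natDegree_of_ne_zero hi).trans (hdeg i ▸ hn.1 i))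
    ((le_natDegree_of_ne_zero hj).trans (hdeg j ▸ hm.1 j))

lemma coeff_ne_zero {u : ι → K[X]} {n : ℕ} (h : HasHeight u n) : (fun i ↦ (u i).coeff n) ≠ 0 := by
  obtain ⟨i, hi⟩ := h.2
  exact fun h0 ↦ hi (congr_fun h0 i)

lemma symProd_coeff {u v : Fin 2 → K[X]} {m n : ℕ} (hu : ∀ i, (u i).natDegree ≤ m)
    (hv : ∀ i, (v i).natDegree ≤ n) (i : Fin 3) :
    (symProd u v i).natDegree ≤ m + n ∧ (symProd u v i).coeff (m + n) =
      symProd (fun j ↦ (u j).coeff m) (fun j ↦ (v j).coeff n) i := by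
  have hd : ∀ i j, (u i * v j).natDegree ≤ m + n := fun i j ↦
    natDegree_mul_le_of_le (hu i) (hv j)
  have hc : ∀ i j, (u i * v j).coeff (m + n) = (u i).coeff m * (v j).coeff n := fun i j ↦
    coeff_mul_add_eq_of_natDegree_le (hu i) (hv j)
  fin_cases i
  · exact ⟨hd 0 0, hc 0 0⟩
  · exact ⟨natDegree_add_le_of_degree_le (hd 0 1) (hd 1 0), by simp [symProd, hc]⟩
  · exact ⟨hd 1 1, hc 1 1⟩

lemma symProd {u v : Fin 2 → K[X]} {m n : ℕ} (hu : HasHeight u m) (hv : HasHeight v n) :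
    HasHeight (symProd u v) (m + n) := by
  refine ⟨fun i ↦ (symProd_coeff hu.1 hv.1 i).1, ?_⟩
  by_contra! hc
  refine symProd_ne_zero hu.coeff_ne_zero hv.coeff_ne_zero ?_
  ext i
  rw [← (symProd_coeff hu.1 hv.1 i).2, hc]
  rfl

lemma exists_of_isCoprime {f g : K[X]} (h : IsCoprime f g) : ∃ n, HasHeight ![f, g] n := by
  rcases le_total f.natDegree g.natDegree with hle | hle
  · by_cases hg : g = 0
    · subst hg
      have hf : f ≠ 0 := (isCoprime_zero_right.1 h).ne_zero
      refine ⟨f.natDegree, fun i ↦ by fin_cases i <;> simp, 0, by simpa⟩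
    · exact ⟨g.natDegree, fun i ↦ by fin_cases i <;> simp [hle], 1, by simpa⟩
  · by_cases hf : f = 0
    · subst hf
      have hg : g ≠ 0 := (isCoprime_zero_left.1 h).ne_zero
      refine ⟨g.natDegree, fun i ↦ by fin_cases i <;> simp, 1, by simpa⟩
    · exact ⟨f.natDegree, fun i ↦ by fin_cases i <;> simp [hle], 0, by simpa⟩

end Polynomial.HasHeight


namespace WeierstrassCurve

lemma _root_.IsPrimitiveFamily.addSubVec {R : Type*} [CommRing R] (W : WeierstrassCurve R)
    [W.IsElliptic] {v : Fin 3 → R} (hv : IsPrimitiveFamily v) :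
    IsPrimitiveFamily (W.addSubVec v) := by
  intro M hM
  by_contra! hc
  obtain ⟨i, hi⟩ := hv M hM
  refine (W.map (Ideal.Quotient.mk M)).addSubVec_ne_zero (v := fun j ↦ Ideal.Quotient.mk M (v j))
    (fun h0 ↦ hi (Ideal.Quotient.eq_zero_iff_mem.1 (congr_fun h0 i))) ?_
  ext j
  rw [← map_addSubVec, Ideal.Quotient.eq_zero_iff_mem.2 (hc j), Pi.zero_apply]

section Height

variable {K : Type*} [Field K] (E : WeierstrassCurve K)

lemma addSubVec_coeff {v : Fin 3 → K[X]} {m : ℕ} (hv : ∀ i, (v i).natDegree ≤ m) (i : Fin 3) :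
    ((E.map C).addSubVec v i).natDegree ≤ m + m ∧
      ((E.map C).addSubVec v i).coeff (m + m) = E.addSubVec (fun j ↦ (v j).coeff m) i := by
  have hd : ∀ (c : K) (i j : Fin 3), (C c * (v i * v j)).natDegree ≤ m + m := fun c i j ↦
    (natDegree_C_mul_le _ _).trans (natDegree_mul_le_of_le (hv i) (hv j))
  have hc : ∀ (c : K) (i j : Fin 3),
      (C c * (v i * v j)).coeff (m + m) = c * ((v i).coeff m * (v j).coeff m) := fun c i j ↦ by
    rw [coeff_C_mul, coeff_mul_add_eq_of_natDegree_le (hv i) (hv j)]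
  rw [eq_vec3 v, eq_vec3 (fun j ↦ _), addSubVec_eq, addSubVec_eq]
  fin_cases i
  · have : v 0 ^ 2 - (E.map C).b₄ * v 0 * v 2 - (E.map C).b₆ * v 1 * v 2 - (E.map C).b₈ * v 2 ^ 2 =
        C 1 * (v 0 * v 0) - C E.b₄ * (v 0 * v 2) - C E.b₆ * (v 1 * v 2) - C E.b₈ * (v 2 * v 2) := by
      simp only [map_b₄, map_b₆, map_b₈, C_1]
      ring
    simp only [Fin.zero_eta, Matrix.cons_val_zero, Matrix.cons_val_one, Matrix.cons_val, this]
    refine ⟨natDegree_sub_le_of_le (natDegree_sub_le_of_le (natDegree_sub_le_of_le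
      (hd _ _ _) (hd _ _ _)) (hd _ _ _)) (hd _ _ _) |>.trans (by simp), ?_⟩
    simp only [coeff_sub, hc]
    ring
  · have : 2 * v 1 * v 0 + (E.map C).b₂ * v 0 * v 2 + (E.map C).b₄ * v 1 * v 2 +
        (E.map C).b₆ * v 2 ^ 2 =
        C 2 * (v 1 * v 0) + C E.b₂ * (v 0 * v 2) + C E.b₄ * (v 1 * v 2) + C E.b₆ * (v 2 * v 2) := by
      simp only [map_b₄, map_b₆, map_b₂, C_ofNat]
      ring
    simp only [Fin.mk_one, Matrix.cons_val_zero, Matrix.cons_val_one, Matrix.cons_val, this]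
    refine ⟨natDegree_add_le_of_le (natDegree_add_le_of_le (natDegree_add_le_of_le
      (hd _ _ _) (hd _ _ _)) (hd _ _ _)) (hd _ _ _) |>.trans (by simp), ?_⟩
    simp only [coeff_add, hc]
    ring
  · have : v 1 ^ 2 - 4 * v 0 * v 2 = C 1 * (v 1 * v 1) - C 4 * (v 0 * v 2) := by
      simp only [C_ofNat, C_1]
      ring
    simp only [Fin.reduceFinMk, Matrix.cons_val_zero, Matrix.cons_val_one, Matrix.cons_val, this]
    refine ⟨natDegree_sub_le_of_le (hd _ _ _) (hd _ _ _) |>.trans (by simp), ?_⟩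
    simp only [coeff_sub, hc]
    ring

lemma _root_.Polynomial.HasHeight.addSubVec [E.IsElliptic] {v : Fin 3 → K[X]} {m : ℕ}
    (hv : HasHeight v m) : HasHeight ((E.map C).addSubVec v) (m + m) := by
  refine ⟨fun i ↦ (E.addSubVec_coeff hv.1 i).1, ?_⟩
  by_contra! hc
  refine E.addSubVec_ne_zero hv.coeff_ne_zero ?_
  ext i
  rw [← (E.addSubVec_coeff hv.1 i).2, hc]
  rfl

variable {E} {L : Type*} [Field L] (φ : K[X] →+* L)

/-- The family `u` consists of homogeneous coordinates of the `x`-coordinate of `T`. -/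
def XCoordinates (T : (E.map (φ.comp C)).toAffine.Point) (u : Fin 2 → K[X]) : Prop :=
  ∃ l : L, l ≠ 0 ∧ ∀ i, φ (u i) = l * T.xRep i

/-- The `x`-coordinate of `T`, a point of a constant curve over an extension of the rational
function field, is a rational function of degree `n`. -/
def XHeight (T : (E.map (φ.comp C)).toAffine.Point) (n : ℕ) : Prop :=
  ∃ u : Fin 2 → K[X], IsPrimitiveFamily u ∧ XCoordinates φ T u ∧ HasHeight u n

variable {φ}

lemma XHeight.of_isCoprime {T : (E.map (φ.comp C)).toAffine.Point} {f g : K[X]}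
    (h : IsCoprime f g) (hT : XCoordinates φ T ![f, g]) {n : ℕ} (hn : HasHeight ![f, g] n) :
    XHeight φ T n :=
  ⟨_, h.isPrimitiveFamily, hT, hn⟩

lemma XCoordinates.exists_xHeight {T : (E.map (φ.comp C)).toAffine.Point}
    {u : Fin 2 → K[X]} (hφ : Function.Injective φ) (hT : XCoordinates φ T u) :
    ∃ n, XHeight φ T n := by
  classical
  obtain ⟨l, hl, hu⟩ := hT
  have hne : u 0 ≠ 0 ∨ u 1 ≠ 0 := by
    by_contra! h
    refine Affine.Point.xRep_ne_zero T ?_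
    ext i
    have h0 := hu i
    fin_cases i <;> simpa [h, hl] using h0
  set g := EuclideanDomain.gcd (u 0) (u 1) with hg
  have hg0 : g ≠ 0 := fun h0 ↦ by
    obtain ⟨h1, h2⟩ := EuclideanDomain.gcd_eq_zero_iff.1 h0
    simp_all
  obtain ⟨a, ha⟩ : g ∣ u 0 := EuclideanDomain.gcd_dvd_left _ _
  obtain ⟨b, hb⟩ : g ∣ u 1 := EuclideanDomain.gcd_dvd_right _ _
  have hco : IsCoprime a b := by
    refine ⟨EuclideanDomain.gcdA (u 0) (u 1), EuclideanDomain.gcdB (u 0) (u 1),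
      mul_left_cancel₀ hg0 ?_⟩
    have := EuclideanDomain.gcd_eq_gcd_ab (u 0) (u 1)
    linear_combination -this - EuclideanDomain.gcdA (u 0) (u 1) * ha -
      EuclideanDomain.gcdB (u 0) (u 1) * hb
  obtain ⟨n, hn⟩ := HasHeight.exists_of_isCoprime hco
  have hφg : φ g ≠ 0 := (map_ne_zero_iff φ hφ).2 hg0
  refine ⟨n, .of_isCoprime hco ⟨l / φ g, div_ne_zero hl hφg, fun i ↦ ?_⟩ hn⟩
  rw [div_mul_eq_mul_div, ← hu, eq_div_iff hφg]
  fin_cases i <;> simp [ha, hb, mul_comm]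

variable [DecidableEq L]

/-- The parallelogram law for the degree of the `x`-coordinate. -/
theorem XHeight.exists_add [E.IsElliptic] (hφ : Function.Injective φ)
    {T U : (E.map (φ.comp C)).toAffine.Point} {d e m : ℕ} (hT : XHeight φ T d)
    (hU : XHeight φ U e) (hm : XHeight φ (T - U) m) :
    ∃ n, XHeight φ (T + U) n ∧ n + m = 2 * (d + e) := by
  obtain ⟨t, ht, ⟨k, hk, hkt⟩, htd⟩ := hT
  obtain ⟨u, hu, ⟨l, hl, hlu⟩, hue⟩ := hU
  obtain ⟨r, hr, ⟨j, hj, hjr⟩, hrm⟩ := hm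
  obtain ⟨q, hq, hqs⟩ := Affine.Point.exists_addSubVec_sym2x T U
  set w := (E.map C).addSubVec (symProd t u) with hw
  have hwp : IsPrimitiveFamily w := (ht.symProd hu).addSubVec _
  have hwh : HasHeight w (d + e + (d + e)) := (htd.symProd hue).addSubVec E
  have hφw : ∀ i, φ (w i) = (k * l) ^ 2 * q * (T + U).sym2x (T - U) i := by
    intro i
    have h1 : (fun j ↦ φ (symProd t u j)) = (k * l) • T.sym2x U := by
      ext j
      fin_cases j <;> simp [symProd, Affine.Point.sym2x, hkt, hlu] <;> ring
    rw [hw, map_addSubVec, h1, map_map, addSubVec_smul, hqs]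
    simp [mul_assoc]
  have hκ : (k * l) ^ 2 * q ≠ 0 := mul_ne_zero (pow_ne_zero 2 (mul_ne_zero hk hl)) hq
  generalize (k * l) ^ 2 * q = κ at hφw hκ
  have h0 : φ (w 0) = κ * ((T + U).xRep 0 * (T - U).xRep 0) := hφw 0
  have h1 : φ (w 1) = κ * ((T + U).xRep 0 * (T - U).xRep 1 + (T + U).xRep 1 * (T - U).xRep 0) :=
    hφw 1
  have h2 : φ (w 2) = κ * ((T + U).xRep 1 * (T - U).xRep 1) := hφw 2
  obtain ⟨n, hn⟩ : ∃ n, XHeight φ (T + U) n := by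
    by_cases hz : (T - U).xRep 1 = 0
    · have hx : (T - U).xRep 0 ≠ 0 := fun hx ↦ Affine.Point.xRep_ne_zero (T - U) <| by
        ext i
        fin_cases i
        exacts [hx, hz]
      refine XCoordinates.exists_xHeight (u := ![w 0, w 1]) hφ
        ⟨κ * (T - U).xRep 0, mul_ne_zero hκ hx, fun i ↦ ?_⟩
      fin_cases i
      · simp [h0]; ring
      · simp [h1, hz]; ring
    · refine XCoordinates.exists_xHeight (u := ![r 1 * w 1 - r 0 * w 2, r 1 * w 2]) hφ
        ⟨j * κ * (T - U).xRep 1 ^ 2, mul_ne_zero (mul_ne_zero hj hκ) (pow_ne_zero 2 hz),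
          fun i ↦ ?_⟩
      fin_cases i
      · simp [h1, h2, hjr]; ring
      · simp [h2, hjr]; ring
  refine ⟨n, hn, ?_⟩
  obtain ⟨s, hs, ⟨i, hi, his⟩, hsn⟩ := hn
  rw [two_mul]
  refine HasHeight.unique_of_cross_mul (hs.symProd hr) hwp (fun a b ↦ hφ ?_) (hsn.symProd hrm) hwh
  have hsr : ∀ c, φ (symProd s r c) = i * j * (T + U).sym2x (T - U) c := by
    intro c
    fin_cases c <;> simp [symProd, Affine.Point.sym2x, his, hjr] <;> ring
  simp only [map_mul, hsr, hφw]
  ring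

lemma XHeight.exists_add_nsmul [E.IsElliptic] (hφ : Function.Injective φ)
    {T U : (E.map (φ.comp C)).toAffine.Point} {d e m : ℕ} (hT : XHeight φ T d)
    (hU : XHeight φ U e) (hm : XHeight φ (T + U) m) (n : ℕ) :
    ∃ k : ℕ, XHeight φ (T + n • U) k ∧ (k : ℤ) = e * n ^ 2 + (m - d - e) * n + d := by
  suffices h : ∃ k l : ℕ, (XHeight φ (T + n • U) k ∧ XHeight φ (T + (n + 1) • U) l) ∧
      (k : ℤ) = e * n ^ 2 + (m - d - e) * n + d ∧
      (l : ℤ) = e * (n + 1) ^ 2 + (m - d - e) * (n + 1) + d by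
    obtain ⟨k, -, ⟨hk, -⟩, hk', -⟩ := h
    exact ⟨k, hk, hk'⟩
  induction n with
  | zero => exact ⟨d, m, by simp [hT, hm], by simp, by simp⟩
  | succ n ih =>
    obtain ⟨k, l, ⟨hk, hl⟩, hk', hl'⟩ := ih
    obtain ⟨r, hr, hrl⟩ := hl.exists_add hφ hU
      (show XHeight φ (T + (n + 1) • U - U) k by rwa [succ_nsmul, ← add_assoc, add_sub_cancel_right])
    refine ⟨l, r, ⟨hl, by rwa [succ_nsmul, ← add_assoc]⟩, by push_cast; exact hl', ?_⟩
    have : (r : ℤ) = 2 * (l + e) - k := by rw [eq_sub_iff_add_eq]; exact_mod_cast hrl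
    rw [this, hk', hl']
    push_cast
    ring

end Height
end WeierstrassCurve

/-- The Lucas sequence `yⁿ + zⁿ`, in terms of the sum `t = y + z` and the product `q = y * z`. -/
def lucasV {R : Type*} [CommRing R] (t q : R) : ℕ → R
  | 0 => 2
  | 1 => t
  | n + 2 => t * lucasV t q (n + 1) - q * lucasV t q n

/-- The product `(yᵖ - z) * (y - zᵖ)`, in terms of `t = y + z` and `q = y * z`. -/
def frobeniusDiff {R : Type*} [CommRing R] (p : ℕ) (t q : R) : R :=
  lucasV t q (p + 1) - q ^ p - q

section Lucas

variable {R S : Type*} [CommRing R] [CommRing S]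

lemma lucasV_add_mul (y z : R) (n : ℕ) : lucasV (y + z) (y * z) n = y ^ n + z ^ n := by
  induction n using Nat.twoStepInduction with
  | zero => simp [lucasV, one_add_one_eq_two]
  | one => simp [lucasV]
  | more n h₁ h₂ => rw [lucasV, h₁, h₂]; ring

lemma map_lucasV (f : R →+* S) (t q : R) (n : ℕ) :
    f (lucasV t q n) = lucasV (f t) (f q) n := by
  induction n using Nat.twoStepInduction with
  | zero => exact map_ofNat f 2
  | one => simp [lucasV]
  | more n h₁ h₂ => simp [lucasV, h₁, h₂]

lemma frobeniusDiff_add_mul (p : ℕ) (y z : R) :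
    frobeniusDiff p (y + z) (y * z) = (y ^ p - z) * (y - z ^ p) := by
  rw [frobeniusDiff, lucasV_add_mul]; ring

lemma map_frobeniusDiff (f : R →+* S) (p : ℕ) (t q : R) :
    f (frobeniusDiff p t q) = frobeniusDiff p (f t) (f q) := by
  simp [frobeniusDiff, map_lucasV]

lemma dvd_lucasV_succ {d t q : R} (ht : d ∣ t) (hq : d ∣ q) (n : ℕ) : d ∣ lucasV t q (n + 1) := by
  cases n with
  | zero => exact ht
  | succ n => exact dvd_sub (ht.mul_right _) (hq.mul_right _)

lemma sq_dvd_lucasV {d t q : R} (ht : d ∣ t) (hq : d ∣ q) (n : ℕ) :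
    d ^ 2 ∣ lucasV t q (n + 3) := by
  rw [sq, lucasV]
  exact dvd_sub (mul_dvd_mul ht (dvd_lucasV_succ ht hq _)) (mul_dvd_mul hq (dvd_lucasV_succ ht hq _))

lemma sq_dvd_frobeniusDiff_add {d t q : R} (ht : d ∣ t) (hq : d ∣ q) {p : ℕ} (hp : 2 ≤ p) :
    d ^ 2 ∣ frobeniusDiff p t q + q := by
  obtain ⟨n, rfl⟩ := Nat.exists_eq_add_of_le' hp
  rw [frobeniusDiff, sub_add_cancel]
  exact dvd_sub (sq_dvd_lucasV ht hq n) ((pow_dvd_pow_of_dvd hq 2).trans (pow_dvd_pow q hp))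

lemma natDegree_lucasV_le {t q : R[X]} (ht : t.natDegree ≤ 1) (hq : q.natDegree ≤ 3) (n : ℕ) :
    2 * (lucasV t q n).natDegree ≤ 3 * n := by
  induction n using Nat.twoStepInduction with
  | zero => simp [lucasV]
  | one => simp only [lucasV]; lia
  | more n h₁ h₂ =>
    have := natDegree_sub_le (t * lucasV t q (n + 1)) (q * lucasV t q n)
    have := natDegree_mul_le (p := t) (q := lucasV t q (n + 1))
    have := natDegree_mul_le (p := q) (q := lucasV t q n)
    simp only [lucasV]
    lia

end Lucas

namespace WeierstrassCurve

section Generic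

variable {R : Type*} [CommRing R] (E : WeierstrassCurve R)

/-- The trace `y + (-y - a₁X - a₃)` of the generic `y`-coordinate. -/
noncomputable def traceY : R[X] := -(C E.a₁ * X + C E.a₃)

/-- The norm `y * (-y - a₁X - a₃)` of the generic `y`-coordinate. -/
noncomputable def normY : R[X] := -(X ^ 3 + C E.a₂ * X ^ 2 + C E.a₄ * X + C E.a₆)

lemma natDegree_traceY_le : E.traceY.natDegree ≤ 1 := by
  unfold traceY; compute_degree

lemma natDegree_normY_le : E.normY.natDegree ≤ 3 := by
  unfold normY; compute_degree

lemma map_traceY {S : Type*} [CommRing S] (φ : R[X] →+* S) (y : S) :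
    φ E.traceY = y + (E.map (φ.comp C)).toAffine.negY (φ X) y := by
  simp only [traceY, Affine.negY, map_a₁, map_a₃, RingHom.comp_apply, map_neg, map_add, map_mul]
  ring

lemma map_normY {S : Type*} [CommRing S] {φ : R[X] →+* S} {y : S}
    (hy : (E.map (φ.comp C)).toAffine.Equation (φ X) y) :
    φ E.normY = y * (E.map (φ.comp C)).toAffine.negY (φ X) y := by
  rw [Affine.equation_iff] at hy
  simp only [normY, Affine.negY, map_a₁, map_a₂, map_a₃, map_a₄, map_a₆, RingHom.comp_apply,
    map_neg, map_add, map_mul, map_pow] at hy ⊢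
  linear_combination hy

end Generic

section FiniteField

variable {p : ℕ} [Fact p.Prime] (E : WeierstrassCurve (ZMod p))

lemma map_map_frobenius {L : Type*} [Field L] [ExpChar L p] (f : ZMod p →+* L) :
    (E.map f).map (frobenius L p) = E.map f := by
  rw [map_map, Subsingleton.elim ((frobenius L p).comp f) f]

lemma eval_frobeniusDiff {c y : ZMod p} (h : E.toAffine.Equation c y) :
    (frobeniusDiff p E.traceY E.normY).eval c = (y - E.toAffine.negY c y) ^ 2 := by
  have e : E.map ((evalRingHom c).comp C) = E := by
    convert E.map_id; ext; simp
  have h' : (E.map ((evalRingHom c).comp C)).toAffine.Equation (evalRingHom c X) y := by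
    rw [e]; simpa using h
  rw [← coe_evalRingHom, map_frobeniusDiff, E.map_traceY (evalRingHom c) y, E.map_normY h',
    frobeniusDiff_add_mul, ZMod.pow_card, ZMod.pow_card, sq, e]
  simp

variable {L : Type*} [Field L] {φ : (ZMod p)[X] →+* L} {y : L}

lemma map_frobeniusDiff_eq (hy : (E.map (φ.comp C)).toAffine.Equation (φ X) y) :
    φ (frobeniusDiff p E.traceY E.normY) = (y ^ p - (E.map (φ.comp C)).toAffine.negY (φ X) y) *
      (y - (E.map (φ.comp C)).toAffine.negY (φ X) y ^ p) := by
  rw [map_frobeniusDiff, E.map_traceY φ y, E.map_normY hy, frobeniusDiff_add_mul]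

lemma frobeniusDiff_shift (hφ : Function.Injective φ)
    (hy : (E.map (φ.comp C)).toAffine.Equation (φ X) y) (b : ZMod p) :
    frobeniusDiff p E.traceY E.normY = frobeniusDiff p (E.traceY - 2 * C b)
      (E.normY - C b * E.traceY + C b ^ 2) := by
  have : CharP L p := charP_of_injective_ringHom (f := φ.comp C) (hφ.comp C_injective) p
  have hb : φ (C b) ^ p = φ (C b) := by rw [← map_pow, ← map_pow, ZMod.pow_card]
  apply hφ
  rw [E.map_frobeniusDiff_eq hy, map_frobeniusDiff]
  simp only [map_sub, map_add, map_mul, map_pow, E.map_traceY φ y, E.map_normY hy, map_ofNat]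
  generalize (E.map (φ.comp C)).toAffine.negY (φ X) y = z
  convert (frobeniusDiff_add_mul p (y - φ (C b)) (z - φ (C b))).symm using 1
  · rw [sub_pow_char, sub_pow_char, hb]; ring
  · congr 1 <;> ring

lemma dvd_frobeniusDiff_of_Y_eq [E.IsElliptic] (hφ : Function.Injective φ)
    (hy : (E.map (φ.comp C)).toAffine.Equation (φ X) y) {c b : ZMod p}
    (h : E.toAffine.Equation c b) (hb : b = E.toAffine.negY c b) :
    X - C c ∣ frobeniusDiff p E.traceY E.normY ∧
      ¬ (X - C c) ^ 2 ∣ frobeniusDiff p E.traceY E.normY := by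
  have hns := (E.toAffine.nonsingular_iff _ _).1 (E.toAffine.equation_iff_nonsingular.1 h)
  replace hns := hns.2.resolve_right (not_not.2 hb)
  rw [E.frobeniusDiff_shift hφ hy b]
  set t := E.traceY - 2 * C b with ht
  set q := E.normY - C b * E.traceY + C b ^ 2 with hq
  have ht' : X - C c ∣ t := by
    rw [dvd_iff_isRoot, IsRoot, ht]
    simp only [traceY, Affine.negY] at hb ⊢
    simp
    linear_combination -hb
  have hq' : X - C c ∣ q := by
    rw [dvd_iff_isRoot, IsRoot, hq]
    rw [Affine.equation_iff] at h
    simp only [traceY, normY] 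
    simp
    linear_combination h
  have key := sq_dvd_frobeniusDiff_add ht' hq' (Fact.out : p.Prime).two_le
  constructor
  · exact (dvd_add_left hq').1 ((dvd_pow_self _ two_ne_zero).trans key)
  · intro h2
    obtain ⟨r, hr⟩ := (dvd_add_right h2).1 key
    have := congr_arg (fun f ↦ (derivative f).eval c) hr
    apply hns
    simp [hq, traceY, normY, derivative_pow] at this
    linear_combination this

end FiniteField
end WeierstrassCurve

lemma ZMod.prod_X_sub_C (p : ℕ) [Fact p.Prime] :
    ∏ c : ZMod p, (X - C c) = (X ^ p - X : (ZMod p)[X]) := by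
  have hp := (Fact.out : p.Prime).one_lt
  have hr : (X ^ p - X : (ZMod p)[X]).roots = Finset.univ.val := by
    simpa [ZMod.card] using FiniteField.roots_X_pow_card_sub_X (ZMod p)
  have hm : (X ^ p - X : (ZMod p)[X]).Monic := monic_X_pow_sub (by rw [degree_X]; exact_mod_cast hp)
  rw [← prod_multiset_X_sub_C_of_monic_of_roots_card_eq hm, hr]
  · rfl
  · rw [hr, FiniteField.X_pow_card_sub_X_natDegree_eq _ hp]
    simp [ZMod.card]

/-- The roots of an irreducible quadratic over `𝔽_p` are exchanged by the Frobenius. -/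
lemma Irreducible.dvd_X_pow_add_X_add_C {p : ℕ} [Fact p.Prime] {b d : ZMod p}
    (h : Irreducible (X ^ 2 + C b * X + C d)) : X ^ 2 + C b * X + C d ∣ X ^ p + X + C b := by
  set f := X ^ 2 + C b * X + C d with hf
  have : Fact (Irreducible f) := ⟨h⟩
  have : CharP (AdjoinRoot f) p := charP_of_injective_ringHom (AdjoinRoot.of f).injective p
  have hdeg : f.natDegree = 2 := by rw [hf]; compute_degree!
  set r := AdjoinRoot.root f with hr
  have hpow : ∀ c : ZMod p, AdjoinRoot.of f c ^ p = AdjoinRoot.of f c := fun c ↦ by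
    rw [← map_pow, ZMod.pow_card]
  have h1 : r ^ 2 + AdjoinRoot.of f b * r + AdjoinRoot.of f d = 0 := by
    simpa [hf] using AdjoinRoot.eval₂_root f
  have h2 : (r ^ p) ^ 2 + AdjoinRoot.of f b * r ^ p + AdjoinRoot.of f d = 0 := by
    have := congr_arg (· ^ p) h1
    simp only [add_pow_char, mul_pow, hpow, zero_pow (Fact.out : p.Prime).ne_zero] at this
    rw [← this]; ring
  have h3 : (r ^ p - r) * (r ^ p + r + AdjoinRoot.of f b) = 0 := by linear_combination h2 - h1
  rw [← AdjoinRoot.mk_eq_zero]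
  refine (mul_eq_zero.1 h3).elim (fun h0 ↦ ?_) (fun h0 ↦ by simpa [hr] using h0)
  exfalso
  have h4 : f ∣ ∏ c : ZMod p, (X - C c) := by
    rw [ZMod.prod_X_sub_C, ← AdjoinRoot.mk_eq_zero]
    simpa [hr] using h0
  obtain ⟨c, -, hc⟩ := h.prime.exists_mem_finset_dvd h4
  have := natDegree_le_of_dvd hc (X_sub_C_ne_zero c)
  rw [natDegree_X_sub_C, hdeg] at this
  lia

namespace WeierstrassCurve

section FiniteField

variable {p : ℕ} [Fact p.Prime] (E : WeierstrassCurve (ZMod p))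
variable {L : Type*} [Field L] {φ : (ZMod p)[X] →+* L} {y : L}

lemma sq_dvd_frobeniusDiff (hφ : Function.Injective φ)
    (hy : (E.map (φ.comp C)).toAffine.Equation (φ X) y) {c : ZMod p}
    (h : ∀ b, ¬ E.toAffine.Equation c b) :
    (X - C c) ^ 2 ∣ frobeniusDiff p E.traceY E.normY := by
  set W := E.toAffine.polynomial with hW
  set F : (ZMod p)[X][X] := X ^ p + X - C E.traceY with hF
  have hWm : W.Monic := Affine.monic_polynomial
  have hW' : W.map (evalRingHom c) = X ^ 2 + C (-E.traceY.eval c) * X + C (E.normY.eval c) := by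
    simp [hW, Affine.polynomial, traceY, normY]
    ring
  have hirr : Irreducible (W.map (evalRingHom c)) := by
    refine irreducible_of_degree_le_three_of_not_isRoot ?_ fun b hb ↦ h b ?_
    · rw [hWm.natDegree_map, Affine.natDegree_polynomial]; simp
    · rw [IsRoot, hW'] at hb
      simp [traceY, normY] at hb
      rw [Affine.equation_iff]
      linear_combination hb
  obtain ⟨v, u, hvu⟩ : ∃ v u, F %ₘ W = C v * X + C u := by
    refine exists_eq_X_add_C_of_natDegree_le_one (Nat.lt_succ_iff.1 ?_)
    have := natDegree_modByMonic_lt F hWm (fun h1 ↦ by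
      have h2 := E.toAffine.natDegree_polynomial
      rw [← hW, h1, natDegree_one] at h2
      lia)
    rwa [Affine.natDegree_polynomial] at this
  have h0 : (F %ₘ W).map (evalRingHom c) = 0 := by
    rw [map_modByMonic _ hWm, modByMonic_eq_zero_iff_dvd (hWm.map _)]
    rw [hW'] at hirr ⊢
    convert hirr.dvd_X_pow_add_X_add_C using 1
    simp [hF, sub_eq_add_neg]
  rw [hvu] at h0
  have hv : X - C c ∣ v := by
    simpa [dvd_iff_isRoot] using congr_arg (coeff · 1) h0
  have hu : X - C c ∣ u := by
    simpa [dvd_iff_isRoot] using congr_arg (coeff · 0) h0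
  have hFe : ∀ w : L, (E.map (φ.comp C)).toAffine.Equation (φ X) w →
      w ^ p + w - φ E.traceY = φ v * w + φ u := fun w hw ↦ by
    have hW0 : eval₂ φ w W = 0 := by
      rw [Affine.equation_iff] at hw
      simp [hW, Affine.polynomial, eval₂_pow] at hw ⊢
      linear_combination hw
    have := congr_arg (eval₂ φ w) (modByMonic_add_div F W)
    rw [eval₂_add, eval₂_mul, hW0, hvu] at this
    simpa [hF] using this.symm
  obtain ⟨v, rfl⟩ := hv
  obtain ⟨u, rfl⟩ := hu
  refine ⟨-(u ^ 2 + u * v * E.traceY + v ^ 2 * E.normY), hφ ?_⟩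
  rw [E.map_frobeniusDiff_eq hy]
  have h1 := hFe _ hy
  have h2 := hFe _ ((Affine.equation_neg _ _ ).2 hy)
  have ht := E.map_traceY φ y
  have hn := E.map_normY hy
  simp only [map_mul, map_neg, map_add, map_pow] at h1 h2 ⊢
  generalize (E.map (φ.comp C)).toAffine.negY (φ X) y = z at h1 h2 ht hn ⊢
  rw [ht] at h1 h2 ⊢
  rw [hn]
  have e1 : y ^ p - z = φ (X - C c) * φ v * y + φ (X - C c) * φ u := by linear_combination h1
  have e2 : y - z ^ p = -(φ (X - C c) * φ v * z + φ (X - C c) * φ u) := by linear_combination -h2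
  rw [e1, e2]
  ring

end FiniteField
end WeierstrassCurve

namespace WeierstrassCurve

/-- The number of points with given `x`-coordinate on the affine part of a Weierstrass curve. -/
noncomputable def fiberCard {R : Type*} [CommRing R] (E : WeierstrassCurve R) (c : R) : ℕ :=
  {b | E.toAffine.Equation c b}.ncard

lemma setOf_equation_eq {F : Type*} [Field F] {W : Affine F} {c b : F} (h : W.Equation c b) :
    {b | W.Equation c b} = {b, W.negY c b} := by
  ext d
  refine ⟨fun hd ↦ Affine.Y_eq_of_X_eq hd h rfl, ?_⟩
  rintro (rfl | rfl)
  exacts [h, (W.equation_neg _ _).2 h]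

lemma natCard_point {R : Type*} [CommRing R] [Nontrivial R] [Fintype R] (E : WeierstrassCurve R)
    [E.IsElliptic] : Nat.card E.toAffine.Point = 1 + ∑ c, E.fiberCard c := by
  classical
  have e : {xy : R × R // E.toAffine.Equation xy.1 xy.2} ≃
      Σ c : R, {b // E.toAffine.Equation c b} :=
    { toFun := fun xy ↦ ⟨xy.1.1, xy.1.2, xy.2⟩
      invFun := fun s ↦ ⟨(s.1, s.2.1), s.2.2⟩
      left_inv := fun _ ↦ rfl
      right_inv := fun _ ↦ rfl }
  rw [Nat.card_congr E.toAffine.pointEquiv]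
  change Nat.card (Option _) = _
  rw [Finite.card_option, Nat.card_congr e, Nat.card_sigma, add_comm]
  rfl

section FiniteField

variable {p : ℕ} [Fact p.Prime] (E : WeierstrassCurve (ZMod p))
variable {L : Type*} [Field L] {φ : (ZMod p)[X] →+* L} {y : L}

lemma frobeniusDiff_local [E.IsElliptic] (hφ : Function.Injective φ)
    (hy : (E.map (φ.comp C)).toAffine.Equation (φ X) y) (c : ZMod p) :
    E.fiberCard c ≤ 2 ∧ (X - C c) ^ (2 - E.fiberCard c) ∣ frobeniusDiff p E.traceY E.normY ∧
      (E.fiberCard c ≠ 0 →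
        ¬ (X - C c) ^ (2 - E.fiberCard c + 1) ∣ frobeniusDiff p E.traceY E.normY) := by
  by_cases h : ∃ b, E.toAffine.Equation c b
  · obtain ⟨b, hb⟩ := h
    by_cases hbn : b = E.toAffine.negY c b
    · have h1 : E.fiberCard c = 1 := by
        rw [fiberCard, setOf_equation_eq hb, ← hbn, Set.pair_eq_singleton, Set.ncard_singleton]
      have := E.dvd_frobeniusDiff_of_Y_eq hφ hy hb hbn
      simpa [h1] using this
    · have h2 : E.fiberCard c = 2 := by
        rw [fiberCard, setOf_equation_eq hb, Set.ncard_pair hbn]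
      have := E.eval_frobeniusDiff hb
      simpa [h2, dvd_iff_isRoot, this, sub_eq_zero] using hbn
  · push Not at h
    have h0 : E.fiberCard c = 0 := by simp [fiberCard, h]
    simpa [h0] using E.sq_dvd_frobeniusDiff hφ hy h

/-- The numerator of the `x`-coordinate of `Frob(P) - P` over the denominator `(Xᵖ - X)²`. -/
noncomputable def frobeniusSubNum : (ZMod p)[X] :=
  frobeniusDiff p E.traceY E.normY - (C E.a₂ + X + X ^ p) * (X ^ p - X) ^ 2

lemma exists_frobeniusSubNum_eq : ∃ r : (ZMod p)[X], r.degree < ((2 * p + 1 : ℕ) : WithBot ℕ) ∧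
    E.frobeniusSubNum = X ^ (2 * p + 1) + r := by
  have hp := (Fact.out : p.Prime).two_le
  refine ⟨lucasV E.traceY E.normY (p + 1) + (X ^ (p + 2) + C (2 * E.a₂) * X ^ (p + 1) +
    C E.a₄ * X ^ p + C E.a₄ * X + C (2 * E.a₆)), ?_, ?_⟩
  · have h1 := natDegree_lucasV_le E.natDegree_traceY_le E.natDegree_normY_le (p + 1)
    refine degree_le_natDegree.trans_lt (WithBot.coe_lt_coe.2 ?_)
    refine (natDegree_add_le _ _).trans_lt (max_lt (by lia) ?_)
    refine lt_of_le_of_lt (b := p + 2) ?_ (by lia)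
    compute_degree
  · have : E.normY ^ p = -(X ^ (3 * p) + C E.a₂ * X ^ (2 * p) + C E.a₄ * X ^ p + C E.a₆) := by
      rw [← ZMod.expand_card]
      simp only [normY, map_neg, map_add, map_mul, map_pow, expand_X, expand_C]
      ring
    rw [frobeniusSubNum, frobeniusDiff, this, normY]
    simp only [C_mul, C_ofNat]
    ring

lemma frobeniusSubNum_monic : E.frobeniusSubNum.Monic := by
  obtain ⟨r, hr, h⟩ := E.exists_frobeniusSubNum_eq
  exact h ▸ monic_X_pow_add hr

lemma natDegree_frobeniusSubNum : E.frobeniusSubNum.natDegree = 2 * p + 1 := by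
  obtain ⟨r, hr, h⟩ := E.exists_frobeniusSubNum_eq
  rw [h, natDegree_add_eq_left_of_degree_lt (by rwa [degree_X_pow]), natDegree_X_pow]

lemma exists_frobeniusSub_coprime [E.IsElliptic] (hφ : Function.Injective φ)
    (hy : (E.map (φ.comp C)).toAffine.Equation (φ X) y) : ∃ f g h : (ZMod p)[X], IsCoprime f g ∧
      h ≠ 0 ∧ g ≠ 0 ∧ E.frobeniusSubNum = h * f ∧ (X ^ p - X) ^ 2 = h * g ∧
      HasHeight ![f, g] (Nat.card E.toAffine.Point) := by
  have hloc := E.frobeniusDiff_local hφ hy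
  set H : (ZMod p)[X] := ∏ c, (X - C c) ^ (2 - E.fiberCard c) with hH
  set g : (ZMod p)[X] := ∏ c, (X - C c) ^ E.fiberCard c with hg
  have hHm : H.Monic := monic_prod_of_monic _ _ fun c _ ↦ (monic_X_sub_C c).pow _
  have hgm : g.Monic := monic_prod_of_monic _ _ fun c _ ↦ (monic_X_sub_C c).pow _
  have hHg : (X ^ p - X) ^ 2 = H * g := by
    rw [← ZMod.prod_X_sub_C, ← Finset.prod_pow, hH, hg, ← Finset.prod_mul_distrib]
    exact Finset.prod_congr rfl fun c _ ↦ by rw [← pow_add, Nat.sub_add_cancel (hloc c).1]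
  obtain ⟨s, hs⟩ : H ∣ frobeniusDiff p E.traceY E.normY := by
    refine Finset.prod_dvd_of_coprime (fun c _ d _ hcd ↦ ?_) fun c _ ↦ (hloc c).2.1
    exact (isCoprime_X_sub_C_of_isUnit_sub (sub_ne_zero.2 hcd).isUnit).pow
  have hsg : IsCoprime s g := by
    refine IsCoprime.prod_right fun c _ ↦ ?_
    rcases eq_or_ne (E.fiberCard c) 0 with h0 | h0
    · simpa [h0] using isCoprime_one_right
    · refine (((irreducible_X_sub_C c).coprime_iff_not_dvd.2 fun hc ↦ ?_).symm).pow_right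
      refine (hloc c).2.2 h0 ?_
      rw [hs, pow_succ]
      exact mul_dvd_mul (Finset.dvd_prod_of_mem _ (Finset.mem_univ c)) hc
  set f := s - (C E.a₂ + X + X ^ p) * g with hf
  have hHf : E.frobeniusSubNum = H * f := by rw [frobeniusSubNum, hs, hHg, hf]; ring
  have hfm : f.Monic := hHm.of_mul_monic_left (hHf ▸ E.frobeniusSubNum_monic)
  have hdg : g.natDegree = ∑ c, E.fiberCard c := by
    rw [hg, natDegree_prod_of_monic _ _ fun c _ ↦ (monic_X_sub_C c).pow _]
    simp
  have hdH : 2 * p = H.natDegree + g.natDegree := by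
    rw [← hHm.natDegree_mul hgm, ← hHg, natDegree_pow,
      FiniteField.X_pow_card_sub_X_natDegree_eq _ (Fact.out : p.Prime).one_lt]
  have hdf : f.natDegree = 1 + ∑ c, E.fiberCard c := by
    have := E.natDegree_frobeniusSubNum
    rw [hHf, hHm.natDegree_mul hfm] at this
    lia
  refine ⟨f, g, H, ?_, hHm.ne_zero, hgm.ne_zero, hHf, hHg, ?_⟩
  · rw [hf, sub_eq_add_neg, ← neg_mul]
    exact IsCoprime.add_mul_right_left hsg _
  · rw [natCard_point]
    refine ⟨fun i ↦ ?_, 0, ?_⟩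
    · fin_cases i <;> simp [hdf, hdg]
    · rw [← hdf]
      simp [hfm]

end FiniteField
end WeierstrassCurve

namespace WeierstrassCurve

section FiniteField

variable {p : ℕ} [Fact p.Prime] {E : WeierstrassCurve (ZMod p)}
variable {L : Type*} [Field L] {φ : (ZMod p)[X] →+* L} {y : L}

lemma equation_pow (hφ : Function.Injective φ)
    (hy : (E.map (φ.comp C)).toAffine.Equation (φ X) y) :
    (E.map (φ.comp C)).toAffine.Equation (φ X ^ p) (y ^ p) := by
  have : CharP L p := charP_of_injective_ringHom (f := φ.comp C) (hφ.comp C_injective) p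
  rw [← E.map_map_frobenius]
  exact hy.map (frobenius L p)

lemma negY_pow_add (hφ : Function.Injective φ) (y : L) :
    (E.map (φ.comp C)).toAffine.negY (φ X) y ^ p + y ^ p = -φ (C E.a₁) * φ X ^ p - φ (C E.a₃) := by
  have : CharP L p := charP_of_injective_ringHom (f := φ.comp C) (hφ.comp C_injective) p
  rw [← add_pow_char, add_comm, ← E.map_traceY φ y, ← map_pow, ← ZMod.expand_card]
  simp only [traceY, map_neg, map_add, map_mul, map_pow, expand_X, expand_C]
  ring

lemma xHeight_some {n : ℕ}
    (h : (E.map (φ.comp C)).toAffine.Nonsingular (φ X ^ n) y) :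
    XHeight φ (.some _ _ h) n := by
  refine .of_isCoprime (f := X ^ n) isCoprime_one_right ⟨1, one_ne_zero, fun i ↦ ?_⟩
    ⟨fun i ↦ ?_, 0, ?_⟩
  · fin_cases i <;> simp
  · fin_cases i <;> simp
  · simp

lemma XHeight.neg {T : (E.map (φ.comp C)).toAffine.Point} {n : ℕ} (h : XHeight φ T n) :
    XHeight φ (-T) n := by
  simpa only [XHeight, XCoordinates, Affine.Point.xRep_neg] using h

/-- The degree of `x(Frob(P) - P)` is the number of rational points. -/
lemma xHeight_frobenius_sub [DecidableEq L] [E.IsElliptic] (hφ : Function.Injective φ)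
    (h : (E.map (φ.comp C)).toAffine.Nonsingular (φ X) y)
    (h' : (E.map (φ.comp C)).toAffine.Nonsingular (φ X ^ p) (y ^ p)) :
    XHeight φ (.some _ _ h' + -.some _ _ h) (Nat.card E.toAffine.Point) := by
  obtain ⟨f, g, k, hfg, hk, hg, hf', hg', hh⟩ := E.exists_frobeniusSub_coprime hφ h.1
  have hD : (X ^ p - X : (ZMod p)[X]) ≠ 0 :=
    FiniteField.X_pow_card_sub_X_ne_zero _ (Fact.out : p.Prime).one_lt
  have hD' : φ X ^ p - φ X ≠ 0 := by
    rwa [← map_pow, ← map_sub, map_ne_zero_iff φ hφ]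
  have hX : φ X ^ p ≠ φ X := sub_ne_zero.1 hD'
  have hk' : φ k ≠ 0 := (map_ne_zero_iff φ hφ).2 hk
  refine .of_isCoprime hfg ⟨φ g, (map_ne_zero_iff φ hφ).2 hg, fun i ↦ ?_⟩ hh
  rw [Affine.Point.neg_some, Affine.Point.add_of_X_ne hX, Affine.Point.xRep_some]
  fin_cases i
  · simp only [Fin.zero_eta, Matrix.cons_val_zero]
    apply mul_left_cancel₀ hk'
    rw [← mul_assoc, ← map_mul, ← map_mul, ← hf', ← hg', frobeniusSubNum, map_sub,
      E.map_frobeniusDiff_eq h.1, Affine.slope_of_X_ne hX, Affine.addX]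
    have ht := E.map_traceY φ y
    have hp := negY_pow_add (E := E) hφ y
    simp only [traceY, map_neg, map_add, map_mul, map_pow, map_sub] at ht ⊢
    generalize (E.map (φ.comp C)).toAffine.negY (φ X) y = z at ht hp ⊢
    have e : y - z ^ p = y ^ p - z + φ (C E.a₁) * (φ X ^ p - φ X) := by
      linear_combination -hp - ht
    rw [e]
    simp only [map_a₁, map_a₂, RingHom.comp_apply]
    field_simp
    ring
  · simp

/-- The degree of `x(Frob(P) - nP)` is nonnegative. -/
lemma frobenius_form_nonneg [E.IsElliptic] (hφ : Function.Injective φ)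
    (hy : (E.map (φ.comp C)).toAffine.Equation (φ X) y) (n : ℤ) :
    0 ≤ n ^ 2 - (p + 1 - Nat.card E.toAffine.Point : ℤ) * n + p := by
  classical
  have h := Affine.equation_iff_nonsingular.1 hy
  have h' := Affine.equation_iff_nonsingular.1 (equation_pow hφ hy)
  have hP : XHeight φ (.some _ _ h) 1 := by
    simpa using xHeight_some (φ := φ) (E := E) (n := 1) (by simpa using h)
  have hQ : XHeight φ (.some _ _ h') p := xHeight_some h'
  have hQP := xHeight_frobenius_sub hφ h h'
  obtain ⟨m, rfl | rfl⟩ := n.eq_nat_or_neg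
  · obtain ⟨k, -, hk⟩ := hQ.exists_add_nsmul hφ hP.neg hQP m
    push_cast at hk
    linarith
  · obtain ⟨k, -, hk⟩ := hQP.exists_add_nsmul (m := p) hφ hP
      (by rwa [add_assoc, neg_add_cancel, add_zero]) (m + 1)
    push_cast at hk
    linarith

end FiniteField

lemma equation_of_map_polynomial_eq_zero {R S : Type*} [CommRing R] [CommRing S]
    {E : WeierstrassCurve R} {ψ : R[X][X] →+* S} (h : ψ E.toAffine.polynomial = 0) :
    (E.map ((ψ.comp C).comp C)).toAffine.Equation (ψ.comp C X) (ψ X) := by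
  unfold Affine.polynomial at h
  simp only [map_add, map_sub, map_mul, map_pow] at h
  rw [Affine.equation_iff]
  simp only [map_a₁, map_a₂, map_a₃, map_a₄, map_a₆, RingHom.comp_apply]
  linear_combination h

/-- The Hasse bound over a prime field. -/
theorem hasse_bound {p : ℕ} [Fact p.Prime] (E : WeierstrassCurve (ZMod p)) [E.IsElliptic] :
    (p + 1 - Nat.card E.toAffine.Point : ℤ) ^ 2 ≤ 4 * p := by
  let ψ : (ZMod p)[X][X] →+* E.toAffine.FunctionField :=
    (algebraMap E.toAffine.CoordinateRing E.toAffine.FunctionField).comp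
      (Affine.CoordinateRing.mk E.toAffine)
  have hφ : Function.Injective (ψ.comp C) :=
    (IsFractionRing.injective E.toAffine.CoordinateRing E.toAffine.FunctionField).comp
      (FaithfulSMul.algebraMap_injective (ZMod p)[X] E.toAffine.CoordinateRing)
  have hy : (E.map ((ψ.comp C).comp C)).toAffine.Equation (ψ.comp C X) (ψ X) := by
    refine equation_of_map_polynomial_eq_zero ?_
    rw [RingHom.comp_apply, AdjoinRoot.mk_self, map_zero]
  have hpos : 0 < Nat.card E.toAffine.Point := by rw [natCard_point]; lia
  have hle : Nat.card E.toAffine.Point ≤ 1 + 2 * p := by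
    have := Finset.sum_le_card_nsmul Finset.univ E.fiberCard 2
      fun c _ ↦ (E.frobeniusDiff_local hφ hy c).1
    rw [Finset.card_univ, ZMod.card, smul_eq_mul] at this
    rw [natCard_point]
    lia
  have hform := frobenius_form_nonneg hφ hy
  generalize Nat.card E.toAffine.Point = N at *
  obtain ⟨k, hk⟩ := Int.even_or_odd' (p + 1 - N : ℤ)
  have hk' := hform k
  rcases hk with hk | hk <;> rw [hk] at hk' ⊢
  · linarith
  · rcases hk'.eq_or_lt with h0 | h0
    · have hp2 : p = 2 := by
        refine ((Fact.out : p.Prime).eq_two_or_odd').resolve_right fun hodd ↦ ?_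
        have h1 : Even (k * (k + 1)) := Int.even_mul_succ_self k
        rw [show k * (k + 1) = p by linarith, Int.even_coe_nat] at h1
        exact Nat.not_even_iff_odd.2 hodd h1
      subst hp2
      push_cast at *
      have : k < 1 := by lia
      have : -2 < k := by lia
      nlinarith
    · linarith [Int.add_one_le_iff.2 h0]

end WeierstrassCurve

/-- Proposition 2.2 of the paper at the level of the reduced curve: for an elliptic curve `E`
over `𝔽_p` with `N_p` rational points (including the point at infinity), there exists
`θ ∈ [0, π]` with `p + 1 − N_p = 2·√p·cos θ`. -/
theorem frobenius_angle_exists (p : ℕ) (hp : p.Prime)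
    (E : WeierstrassCurve (ZMod p)) [E.IsElliptic] (Np : ℕ)
    (hNp : Np = Nat.card E.toAffine.Point) :
    ∃ θ : ℝ, 0 ≤ θ ∧ θ ≤ Real.pi ∧
      ((p : ℝ) + 1 - (Np : ℝ)) = 2 * Real.sqrt p * Real.cos θ := by
  have : Fact p.Prime := ⟨hp⟩
  have h : ((p : ℝ) + 1 - Np) ^ 2 ≤ (2 * √p) ^ 2 := by
    rw [mul_pow, Real.sq_sqrt p.cast_nonneg, hNp]
    norm_num1
    exact_mod_cast E.hasse_bound
  have hp0 : 0 < 2 * √(p : ℝ) := by have := hp.pos; positivity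
  obtain ⟨h₁, h₂⟩ := abs_le.1 (abs_le_of_sq_le_sq h hp0.le)
  refine ⟨Real.arccos (((p : ℝ) + 1 - Np) / (2 * √p)), Real.arccos_nonneg _, Real.arccos_le_pi _, ?_⟩
  rw [Real.cos_arccos, mul_div_cancel₀ _ hp0.ne']
  · rwa [le_div_iff₀ hp0, neg_one_mul]
  · rwa [div_le_one hp0]
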